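/- Let μ be a positive finite Borel measure on (0,1), let 1 ≤ p < ∞, and let α, β > -1 with β - α > -1. Then H_μ^{α,β} is bounded from l^p_{w₁} into l^p_{w₂} if and only if C_μ(β,p) = ∫_{(0,1)} (1-t)^{-(1-1/p)(β+1)} t^{-(β+1)/p} dμ(t) < ∞. Moreover, when H_μ^{α,β} : l^p_{w₁} → l^p_{w₂} is bounded, its operator norm equals C_μ(β,p). -/

import Mathlib

open MeasureTheory Set

/-- `(γ+1)_s = Γ(γ+s+1)/Γ(γ+1)`. -/
noncomputable def poch (γ s : ℝ) : ℝ := Real.Gamma (γ + s + 1) / Real.Gamma (γ + 1)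

/-- `k_{α,β}(m,n) = Γ(n+m+β+1)/(Γ(m+α+1)Γ(n+β-α+1))`. -/
noncomputable def kker (α β : ℝ) (m n : ℕ) : ℝ :=
  Real.Gamma ((n : ℝ) + (m : ℝ) + β + 1) /
    (Real.Gamma ((m : ℝ) + α + 1) * Real.Gamma ((n : ℝ) + β - α + 1))

/-- The operator `H_μ^{α,β}(a)(n) = ∑_m ∫_{(0,1)} k_{α,β}(m,n) t^m (1-t)^n a_m dμ(t)`. -/
noncomputable def Hab (μ : Measure ℝ) (α β : ℝ) (a : ℕ → ℂ) (n : ℕ) : ℂ :=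
  ∑' m : ℕ, ∫ t in Ioo (0 : ℝ) 1, (kker α β m n * t ^ m * (1 - t) ^ n) • a m ∂μ

/-- The weight `w₁(m) = (m+1)_α^{-p} (m+1)_β`. -/
noncomputable def w1 (α β p : ℝ) (m : ℕ) : ℝ := (poch (m : ℝ) α) ^ (-p) * poch (m : ℝ) β

/-- The weight `w₂(m) = (m+β-α+1)_α^{-p} (m+1)_β`. -/
noncomputable def w2 (α β p : ℝ) (m : ℕ) : ℝ :=
  (poch ((m : ℝ) + β - α) α) ^ (-p) * poch (m : ℝ) β

open Filter Topology
lemma gser (x t : ℝ) (hx : 0 < x) (h0 : 0 < t) (h1 : t < 1) :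
    ∑' m : ℕ, ENNReal.ofReal (Real.Gamma (m + x) / m.factorial * t ^ m) =
      ENNReal.ofReal (Real.Gamma x * (1 - t) ^ (-x)) := by
  have key : ∀ (y r : ℝ), 0 < y → 0 < r → ENNReal.ofReal (r ^ (-y) * Real.Gamma y) =
      ∫⁻ u in Ioi (0:ℝ), ENNReal.ofReal (u ^ (y - 1) * Real.exp (-(r * u))) := by
    intro y r hy hr
    have hI := Real.integral_rpow_mul_exp_neg_mul_Ioi hy hr
    have hpos : 0 < r ^ (-y) * Real.Gamma y :=
      mul_pos (Real.rpow_pos_of_pos hr _) (Real.Gamma_pos_of_pos hy)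
    have heq : (1 / r) ^ y * Real.Gamma y = r ^ (-y) * Real.Gamma y := by
      rw [one_div, Real.inv_rpow hr.le, Real.rpow_neg hr.le]
    rw [heq] at hI
    rw [← hI]
    refine ofReal_integral_eq_lintegral_ofReal ?_ ?_
    · by_contra hn
      rw [integral_undef hn] at hI
      linarith
    · refine (ae_restrict_iff' measurableSet_Ioi).2 (Eventually.of_forall fun u hu => ?_)
      have hu' : (0:ℝ) < u := hu
      positivity
  have e1 : ∀ m : ℕ, ENNReal.ofReal (Real.Gamma (m + x) / m.factorial * t ^ m) =
      ∫⁻ u in Ioi (0:ℝ), ENNReal.ofReal ((t * u) ^ m / m.factorial) * 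
        ENNReal.ofReal (u ^ (x - 1) * Real.exp (-u)) := by
    intro m
    have h := key (m + x) 1 (by positivity) one_pos
    rw [Real.one_rpow, one_mul] at h
    have h2 : Real.Gamma (m + x) / m.factorial * t ^ m =
      (t ^ m / m.factorial) * Real.Gamma (m + x) := by ring
    rw [h2, ENNReal.ofReal_mul (by positivity), h, ← lintegral_const_mul' _ _ ENNReal.ofReal_ne_top]
    refine setLIntegral_congr_fun measurableSet_Ioi fun u hu => ?_
    have hu' : (0:ℝ) < u := hu
    rw [← ENNReal.ofReal_mul (by positivity), ← ENNReal.ofReal_mul (by positivity)]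
    congr 1
    rw [show (m:ℝ) + x - 1 = (x - 1) + m by ring, Real.rpow_add_natCast hu'.ne', mul_pow, one_mul]
    ring
  simp_rw [e1]
  rw [← lintegral_tsum]
  · rw [mul_comm, key x (1 - t) hx (by linarith)]
    refine setLIntegral_congr_fun measurableSet_Ioi fun u hu => ?_
    have hu' : (0:ℝ) < u := hu
    rw [ENNReal.tsum_mul_right]
    have hs : HasSum (fun m : ℕ => (t * u) ^ m / m.factorial) (Real.exp (t * u)) := by
      rw [Real.exp_eq_exp_ℝ]
      exact NormedSpace.expSeries_div_hasSum_exp _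
    rw [← ENNReal.ofReal_tsum_of_nonneg (fun n => by positivity) hs.summable, hs.tsum_eq,
      ← ENNReal.ofReal_mul (by positivity)]
    congr 1
    rw [show -((1 - t) * u) = t * u + -u by ring, Real.exp_add]
    ring
  · intro m
    fun_prop

lemma whold {Ω : Type*} [MeasurableSpace Ω] (ν : Measure Ω) (p : ℝ) (hp : 1 ≤ p)
    (k φ g : Ω → ENNReal) (hk : Measurable k) (hφ : Measurable φ) (hg : Measurable g)
    (g0 : ∀ x, g x ≠ 0) (gt : ∀ x, g x ≠ ⊤) :
    (∫⁻ x, k x * φ x ∂ν) ^ p ≤ (∫⁻ x, k x * g x ∂ν) ^ (p - 1) *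
      ∫⁻ x, k x * (g x ^ (1 - p) * φ x ^ p) ∂ν := by
  rcases hp.eq_or_lt with rfl | hp1
  · simp
  have hp0 : 0 < p := by linarith
  have hq : Real.HolderConjugate (p / (p - 1)) p := by
    rw [Real.holderConjugate_iff]
    constructor
    · rw [lt_div_iff₀ (by linarith)]; linarith
    · field_simp; ring
  have h := ENNReal.lintegral_mul_le_Lp_mul_Lq ν hq
    (f := fun x => (k x * g x) ^ ((p - 1) / p))
    (g := fun x => (k x * (g x ^ (1 - p) * φ x ^ p)) ^ (1 / p))
    (by fun_prop) (by fun_prop)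
  have e1 : ∀ x, (k x * g x) ^ ((p - 1) / p) * (k x * (g x ^ (1 - p) * φ x ^ p)) ^ (1 / p) 
      = k x * φ x := by
    intro x
    have a1 : (0:ℝ) ≤ (p - 1) / p := div_nonneg (by linarith) hp0.le
    have a2 : (0:ℝ) ≤ 1 / p := by positivity
    rw [ENNReal.mul_rpow_of_nonneg _ _ a1, ENNReal.mul_rpow_of_nonneg _ _ a2,
      ENNReal.mul_rpow_of_nonneg _ _ a2, ← ENNReal.rpow_mul, ← ENNReal.rpow_mul]
    have b1 : k x ^ ((p - 1) / p) * k x ^ (1 / p) = k x := by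
      rw [← ENNReal.rpow_add_of_nonneg _ _ a1 a2]
      rw [show (p - 1) / p + 1 / p = 1 by field_simp; ring, ENNReal.rpow_one]
    have b2 : g x ^ ((p - 1) / p) * g x ^ ((1 - p) * (1 / p)) = 1 := by
      rw [← ENNReal.rpow_add _ _ (g0 x) (gt x)]
      rw [show (p - 1) / p + (1 - p) * (1 / p) = 0 by field_simp; ring, ENNReal.rpow_zero]
    rw [show p * (1 / p) = 1 by field_simp, ENNReal.rpow_one]
    calc _ = (k x ^ ((p - 1) / p) * k x ^ (1 / p)) * 
        (g x ^ ((p - 1) / p) * g x ^ ((1 - p) * (1 / p))) * φ x := by ring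
      _ = _ := by rw [b1, b2, mul_one]
  simp only [Pi.mul_apply, e1, ← ENNReal.rpow_mul] at h
  rw [show (p - 1) / p * (p / (p - 1)) = 1 by
    have : p - 1 ≠ 0 := by linarith
    field_simp, show 1 / p * p = 1 by field_simp] at h
  simp only [ENNReal.rpow_one] at h
  calc _ ≤ _ := ENNReal.rpow_le_rpow h hp0.le
    _ = _ := by
      rw [ENNReal.mul_rpow_of_nonneg _ _ hp0.le, ← ENNReal.rpow_mul, ← ENNReal.rpow_mul]
      rw [show 1 / (p / (p - 1)) * p = p - 1 by field_simp, show 1 / p * p = 1 by field_simp,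
        ENNReal.rpow_one]

noncomputable def vv (β : ℝ) (n : ℕ) : ℝ := Real.Gamma (n + β + 1) / n.factorial

noncomputable def KK (β : ℝ) (m n : ℕ) (t : ℝ) : ℝ :=
  Real.Gamma (n + m + β + 1) / (m.factorial * Real.Gamma (n + β + 1)) * t ^ m * (1 - t) ^ n

noncomputable def KE (β : ℝ) (m n : ℕ) (t : ℝ) : ENNReal := ENNReal.ofReal (KK β m n t)

lemma gpos {β : ℝ} (hβ : -1 < β) (n : ℕ) : 0 < Real.Gamma (n + β + 1) := 
  Real.Gamma_pos_of_pos (by have : (0:ℝ) ≤ n := n.cast_nonneg; linarith)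

lemma gpos2 {β : ℝ} (hβ : -1 < β) (n m : ℕ) : 0 < Real.Gamma (n + m + β + 1) := 
  Real.Gamma_pos_of_pos (by
    have : (0:ℝ) ≤ n := n.cast_nonneg
    have : (0:ℝ) ≤ m := m.cast_nonneg
    linarith)

lemma vv_pos {β : ℝ} (hβ : -1 < β) (n : ℕ) : 0 < vv β n := by
  have := gpos hβ n
  unfold vv; positivity

lemma KK_nonneg {β : ℝ} (hβ : -1 < β) (m n : ℕ) {t : ℝ} (ht : t ∈ Ioo (0:ℝ) 1) :
    0 ≤ KK β m n t := by
  have := gpos hβ n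
  have := gpos2 hβ n m
  have := ht.1
  have : 0 < 1 - t := by linarith [ht.2]
  unfold KK; positivity

lemma KE_meas (β : ℝ) (m n : ℕ) : Measurable (KE β m n) := by
  unfold KE KK; fun_prop

lemma KE_sum_m {β : ℝ} (hβ : -1 < β) (n : ℕ) {t : ℝ} (ht : t ∈ Ioo (0:ℝ) 1) :
    ∑' m, KE β m n t = ENNReal.ofReal ((1 - t) ^ (-(β + 1))) := by
  have h1t : 0 < 1 - t := by linarith [ht.2]
  have hg := gpos hβ n
  have h := gser (n + β + 1) t 
    (by have : (0:ℝ) ≤ n := n.cast_nonneg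
        linarith) ht.1 ht.2
  have e : ∀ m, KE β m n t = ENNReal.ofReal ((1 - t) ^ n / Real.Gamma (n + β + 1)) * 
      ENNReal.ofReal (Real.Gamma (m + (n + β + 1)) / m.factorial * t ^ m) := by
    intro m
    rw [← ENNReal.ofReal_mul (by positivity)]
    unfold KE KK
    congr 1
    rw [show (m:ℝ) + (n + β + 1) = n + m + β + 1 by ring]
    field_simp
  simp_rw [e]
  rw [ENNReal.tsum_mul_left, h, ← ENNReal.ofReal_mul (by positivity)]
  congr 1
  rw [show -(↑n + β + 1) = -(β + 1) - n by ring, Real.rpow_sub_natCast h1t.ne']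
  field_simp

lemma KE_sum_n {β : ℝ} (hβ : -1 < β) (m : ℕ) {t : ℝ} (ht : t ∈ Ioo (0:ℝ) 1) :
    ∑' n, ENNReal.ofReal (vv β n) * KE β m n t =
      ENNReal.ofReal (vv β m) * ENNReal.ofReal (t ^ (-(β + 1))) := by
  have h1t : 0 < 1 - t := by linarith [ht.2]
  have h0t := ht.1
  have hg := gpos hβ m
  have h := gser (m + β + 1) (1 - t)
    (by have : (0:ℝ) ≤ m := m.cast_nonneg
        linarith) h1t (by linarith)
  have e : ∀ n, ENNReal.ofReal (vv β n) * KE β m n t = ENNReal.ofReal (t ^ m / m.factorial) * 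
      ENNReal.ofReal (Real.Gamma (n + (m + β + 1)) / n.factorial * (1 - t) ^ n) := by
    intro n
    have hg := gpos hβ n
    rw [← ENNReal.ofReal_mul (by positivity)]
    unfold KE KK
    rw [← ENNReal.ofReal_mul (vv_pos hβ n).le]
    congr 1
    unfold vv
    rw [show (n:ℝ) + (m + β + 1) = n + m + β + 1 by ring]
    field_simp
  simp_rw [e]
  rw [ENNReal.tsum_mul_left, h, ← ENNReal.ofReal_mul (by positivity), 
    ← ENNReal.ofReal_mul (vv_pos hβ m).le]
  congr 1
  rw [show -(↑m + β + 1) = -(β + 1) - m by ring, show 1 - (1 - t) = t by ring,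
    Real.rpow_sub_natCast h0t.ne']
  unfold vv
  field_simp

lemma KE_mean {β : ℝ} (hβ : -1 < β) (n : ℕ) {t : ℝ} (ht : t ∈ Ioo (0:ℝ) 1) :
    ∑' m : ℕ, KE β m n t * ((m:ENNReal) + 1) =
      ENNReal.ofReal ((1 - t) ^ (-(β + 1)) * ((t * (n + β) + 1) / (1 - t))) := by
  have h1t : 0 < 1 - t := by linarith [ht.2]
  have h0t := ht.1
  have hg := gpos hβ n
  have hn : (0:ℝ) ≤ n := n.cast_nonneg
  have h := KE_sum_m hβ (n + 1) ht
  have hnb : 0 < (n:ℝ) + β + 1 := by linarith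
  have e : ∀ m : ℕ, KE β (m + 1) n t * (((m + 1 : ℕ)):ENNReal) = 
      ENNReal.ofReal (t * (n + β + 1) / (1 - t)) * KE β m (n + 1) t := by
    intro m
    unfold KE
    rw [← ENNReal.ofReal_natCast, ← ENNReal.ofReal_mul (KK_nonneg hβ _ _ ht), 
      ← ENNReal.ofReal_mul (by positivity)]
    unfold KK
    congr 1
    have : Real.Gamma (((n + 1 : ℕ):ℝ) + β + 1) = (n + β + 1) * Real.Gamma (n + β + 1) := by
      rw [← Real.Gamma_add_one hnb.ne']
      congr 1
      push_cast; ring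
    rw [this, show (n:ℝ) + ((m + 1 : ℕ):ℝ) + β + 1 = ((n + 1 : ℕ):ℝ) + m + β + 1 by push_cast; ring,
      Nat.factorial_succ]
    push_cast
    have : (m:ℝ) + 1 ≠ 0 := by positivity
    field_simp
    ring
  simp_rw [mul_add, mul_one]
  rw [ENNReal.tsum_add, KE_sum_m hβ n ht, tsum_eq_zero_add' ENNReal.summable]
  simp_rw [e]
  rw [ENNReal.tsum_mul_left, h, Nat.cast_zero, mul_zero, zero_add,
    ← ENNReal.ofReal_mul (by positivity), ← ENNReal.ofReal_add (by positivity) (by positivity)]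
  congr 1
  field_simp
  ring

/-- The integrand of `C_μ(β,p)`. -/
noncomputable def cc (p β t : ℝ) : ENNReal :=
  ENNReal.ofReal ((1 - t) ^ (-(1 - 1 / p) * (β + 1)) * t ^ (-((β + 1) / p)))

noncomputable def gg (p β t : ℝ) : ENNReal :=
  ENNReal.ofReal (Real.exp ((β + 1) / p * (Real.log (1 - t) - Real.log t)))

lemma gg_eq1 {p β t : ℝ} (hp : 1 ≤ p) (ht : t ∈ Ioo (0:ℝ) 1) :
    ENNReal.ofReal ((1 - t) ^ (-(β + 1))) * gg p β t = cc p β t := by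
  have h1t : 0 < 1 - t := by linarith [ht.2]
  have h0t := ht.1
  unfold gg cc
  rw [← ENNReal.ofReal_mul (by positivity), Real.rpow_def_of_pos h1t, Real.rpow_def_of_pos h1t,
    Real.rpow_def_of_pos h0t, ← Real.exp_add, ← Real.exp_add]
  congr 2
  have : p ≠ 0 := by linarith
  field_simp
  ring

lemma gg_eq2 {p β t : ℝ} (hp : 1 ≤ p) (ht : t ∈ Ioo (0:ℝ) 1) :
    ENNReal.ofReal (t ^ (-(β + 1))) * gg p β t ^ (1 - p) = cc p β t := by
  have h1t : 0 < 1 - t := by linarith [ht.2]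
  have h0t := ht.1
  unfold gg cc
  rw [ENNReal.ofReal_rpow_of_pos (Real.exp_pos _), ← ENNReal.ofReal_mul (by positivity),
    Real.rpow_def_of_pos h1t, Real.rpow_def_of_pos h0t, Real.rpow_def_of_pos h0t,
    ← Real.exp_mul, ← Real.exp_add, ← Real.exp_add]
  congr 2
  have : p ≠ 0 := by linarith
  field_simp
  ring

lemma gg_meas (p β : ℝ) : Measurable (gg p β) := by
  unfold gg; fun_prop

lemma upperE (μ : Measure ℝ) [IsFiniteMeasure μ] {p β : ℝ} (hp : 1 ≤ p) (hβ : -1 < β)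
    (b : ℕ → ENNReal) :
    ∑' n, ENNReal.ofReal (vv β n) *
      (∑' m, ∫⁻ t in Ioo (0:ℝ) 1, KE β m n t * b m ∂μ) ^ p ≤
    (∫⁻ t in Ioo (0:ℝ) 1, cc p β t ∂μ) ^ p * ∑' m, ENNReal.ofReal (vv β m) * b m ^ p := by
  set ν := μ.restrict (Ioo (0:ℝ) 1) with hν
  set C := ∫⁻ t, cc p β t ∂ν with hC
  have hae : ∀ᵐ t ∂ν, t ∈ Ioo (0:ℝ) 1 := ae_restrict_mem measurableSet_Ioo
  have hpr : ∀ f : ℕ → ℝ → ENNReal, (∀ m, Measurable (f m)) →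
      ∫⁻ z : ℕ × ℝ, f z.1 z.2 ∂(Measure.count.prod ν) = ∑' m, ∫⁻ t, f m t ∂ν := by
    intro f hf
    rw [lintegral_prod, lintegral_count]
    exact (measurable_from_prod_countable_right (f := fun z : ℕ × ℝ => f z.1 z.2) hf).aemeasurable
  have gm := gg_meas p β
  have km := KE_meas β
  have h1 : ∀ n, (∑' m, ∫⁻ t, KE β m n t * b m ∂ν) ^ p ≤ C ^ (p - 1) *
      ∑' m, ∫⁻ t, KE β m n t * (gg p β t ^ (1 - p) * b m ^ p) ∂ν := by
    intro n
    have h := whold (Measure.count.prod ν) p hp (fun z : ℕ × ℝ => KE β z.1 n z.2)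
      (fun z => b z.1) (fun z => gg p β z.2)
      (measurable_from_prod_countable_right fun m => km m n)
      (measurable_from_prod_countable_right fun m => by simp only; exact measurable_const)
      (by fun_prop) (fun z => by simp [gg, Real.exp_pos]) (fun z => by simp [gg])
    rw [hpr (fun m t => KE β m n t * b m) (fun m => by fun_prop),
      hpr (fun m t => KE β m n t * gg p β t) (fun m => by fun_prop),
      hpr (fun m t => KE β m n t * (gg p β t ^ (1 - p) * b m ^ p)) (fun m => by fun_prop)] at h
    have e : ∑' m, ∫⁻ t, KE β m n t * gg p β t ∂ν = C := by
      rw [← lintegral_tsum (fun m => by fun_prop)]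
      refine lintegral_congr_ae ?_
      filter_upwards [hae] with t ht
      rw [ENNReal.tsum_mul_right, KE_sum_m hβ n ht, gg_eq1 hp ht]
    rw [e] at h
    exact h
  calc _ ≤ ∑' n, ENNReal.ofReal (vv β n) * (C ^ (p - 1) *
      ∑' m, ∫⁻ t, KE β m n t * (gg p β t ^ (1 - p) * b m ^ p) ∂ν) := 
        ENNReal.tsum_le_tsum fun n => mul_le_mul_right (h1 n) _
    _ = C ^ (p - 1) * ∑' n, ∑' m, ∫⁻ t, ENNReal.ofReal (vv β n) * 
          (KE β m n t * (gg p β t ^ (1 - p) * b m ^ p)) ∂ν := by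
        rw [← ENNReal.tsum_mul_left]
        refine tsum_congr fun n => ?_
        rw [mul_left_comm, ← ENNReal.tsum_mul_left]
        congr 1
        refine tsum_congr fun m => ?_
        rw [lintegral_const_mul' _ _ ENNReal.ofReal_ne_top]
    _ = C ^ (p - 1) * ∑' m, C * (ENNReal.ofReal (vv β m) * b m ^ p) := by
        rw [ENNReal.tsum_comm]
        congr 1
        refine tsum_congr fun m => ?_
        rw [← lintegral_tsum (fun m => by fun_prop), hC, ← lintegral_mul_const]
        · refine lintegral_congr_ae ?_
          filter_upwards [hae] with t ht
          simp_rw [← mul_assoc]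
          rw [ENNReal.tsum_mul_right, ENNReal.tsum_mul_right, KE_sum_n hβ m ht, ← gg_eq2 hp ht]
          ring
        · unfold cc; fun_prop
    _ = _ := by
        rw [ENNReal.tsum_mul_left, ← mul_assoc]
        congr 1
        conv_rhs => rw [show p = (p - 1) + 1 by ring, 
          ENNReal.rpow_add_of_nonneg _ _ (by linarith) zero_le_one, ENNReal.rpow_one]

lemma poch_m_pos {α : ℝ} (hα : -1 < α) (m : ℕ) : 0 < poch m α := by
  unfold poch
  exact div_pos (gpos hα m) (Real.Gamma_pos_of_pos (by positivity))

lemma poch_beta (β : ℝ) (m : ℕ) : poch m β = vv β m := by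
  unfold poch vv
  rw [Real.Gamma_nat_eq_factorial]

lemma poch_n_pos {α β : ℝ} (hβ : -1 < β) (hβα : -1 < β - α) (n : ℕ) :
    0 < poch ((n:ℝ) + β - α) α := by
  unfold poch
  have h1 := gpos hβ n
  have h2 := gpos hβα n
  rw [show (n:ℝ) + β - α + α + 1 = n + β + 1 by ring,
    show (n:ℝ) + β - α + 1 = n + (β - α) + 1 by ring]
  positivity

lemma wt_eq {q v r p : ℝ} (hq : 0 < q) (hv : 0 < v) (hr : 0 ≤ r) (hp : 1 ≤ p) :
    ENNReal.ofReal (q ^ (-p) * v * r ^ p) = 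
      ENNReal.ofReal v * ENNReal.ofReal (r / q) ^ p := by
  rw [ENNReal.ofReal_rpow_of_nonneg (by positivity) (by linarith),
    ← ENNReal.ofReal_mul hv.le, Real.div_rpow hr hq.le, Real.rpow_neg hq.le]
  congr 1
  ring

lemma w1_eq {α β p r : ℝ} (hp : 1 ≤ p) (hα : -1 < α) (hβ : -1 < β) (hr : 0 ≤ r) (m : ℕ) :
    ENNReal.ofReal (w1 α β p m * r ^ p) = 
      ENNReal.ofReal (vv β m) * ENNReal.ofReal (r / poch m α) ^ p := by
  unfold w1
  rw [poch_beta β, wt_eq (poch_m_pos hα m) (vv_pos hβ m) hr hp]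

lemma w2_eq {α β p r : ℝ} (hp : 1 ≤ p) (hβ : -1 < β) (hβα : -1 < β - α) (hr : 0 ≤ r)
    (m : ℕ) :
    ENNReal.ofReal (w2 α β p m * r ^ p) = 
      ENNReal.ofReal (vv β m) * ENNReal.ofReal (r / poch ((m:ℝ) + β - α) α) ^ p := by
  unfold w2
  rw [poch_beta β, wt_eq (poch_n_pos hβ hβα m) (vv_pos hβ m) hr hp]

lemma kker_eq {α β : ℝ} (hα : -1 < α) (hβ : -1 < β) (hβα : -1 < β - α) (m n : ℕ) (t : ℝ) :
    kker α β m n * t ^ m * (1 - t) ^ n = 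
      KK β m n t * poch ((n:ℝ) + β - α) α / poch m α := by
  have h1 := gpos hβ n
  have h2 := gpos hβα n
  have h3 := gpos hα m
  unfold kker KK poch
  rw [Real.Gamma_nat_eq_factorial, show (n:ℝ) + β - α + α + 1 = n + β + 1 by ring,
    show (n:ℝ) + β - α + 1 = n + (β - α) + 1 by ring]
  field_simp

/-- The predicate: `M` is a bound. -/
def Bd (μ : Measure ℝ) (p α β M : ℝ) : Prop :=
  ∀ a : ℕ → ℂ, Summable (fun m : ℕ => w1 α β p m * ‖a m‖ ^ p) →
        ∑' n : ℕ, ENNReal.ofReal (w2 α β p n * ‖Hab μ α β a n‖ ^ p) ≤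
          ENNReal.ofReal M ^ p *
            ∑' m : ℕ, ENNReal.ofReal (w1 α β p m * ‖a m‖ ^ p)

lemma upper (μ : Measure ℝ) [IsFiniteMeasure μ] {p α β : ℝ}
    (hp : 1 ≤ p) (hα : -1 < α) (hβ : -1 < β) (hβα : -1 < β - α)
    (hC : ∫⁻ t in Ioo (0:ℝ) 1, cc p β t ∂μ ≠ ⊤) :
    Bd μ p α β (∫⁻ t in Ioo (0:ℝ) 1, cc p β t ∂μ).toReal := by
  intro a _
  rw [ENNReal.ofReal_toReal hC]
  simp_rw [w1_eq hp hα hβ (norm_nonneg _), w2_eq hp hβ hβα (norm_nonneg _)]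
  refine le_trans (ENNReal.tsum_le_tsum fun n => ?_) (upperE μ hp hβ _)
  refine mul_le_mul_right (ENNReal.rpow_le_rpow ?_ (by linarith)) _
  have hq := poch_n_pos hβ hβα n
  rw [ENNReal.ofReal_div_of_pos hq, ofReal_norm]
  refine ENNReal.div_le_of_le_mul ?_
  refine enorm_tsum_le_tsum_enorm.trans ?_
  rw [← ENNReal.tsum_mul_right]
  refine ENNReal.tsum_le_tsum fun m => ?_
  refine (enorm_integral_le_lintegral_enorm _).trans ?_
  rw [← lintegral_mul_const' _ _ ENNReal.ofReal_ne_top]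
  refine le_of_eq (setLIntegral_congr_fun measurableSet_Ioo fun t ht => ?_)
  have hk := KK_nonneg hβ m n ht
  have hq' := poch_m_pos hα m
  simp only [kker_eq hα hβ hβα]
  rw [enorm_smul, Real.enorm_of_nonneg (by positivity), ← ofReal_norm, KE,
    ← ENNReal.ofReal_mul (by positivity), ← ENNReal.ofReal_mul (by positivity),
    ← ENNReal.ofReal_mul (by positivity)]
  congr 1
  ring

lemma lowerE (μ : Measure ℝ) [IsFiniteMeasure μ] {p α β M : ℝ}
    (hp : 1 ≤ p) (hα : -1 < α) (hβ : -1 < β) (hβα : -1 < β - α) (hB : Bd μ p α β M)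
    (b : ℕ → ℝ) (hb : ∀ m, 0 ≤ b m) :
    ∑' n, ENNReal.ofReal (vv β n) *
      (∑' m, ∫⁻ t in Ioo (0:ℝ) 1, KE β m n t * ENNReal.ofReal (b m) ∂μ) ^ p ≤
    ENNReal.ofReal M ^ p * ∑' m, ENNReal.ofReal (vv β m) * ENNReal.ofReal (b m) ^ p := by
  have hp0 : 0 < p := by linarith
  have hN : ∀ N : ℕ, ∑' n, ENNReal.ofReal (vv β n) *
      (∑ m ∈ Finset.range N, ∫⁻ t in Ioo (0:ℝ) 1, KE β m n t * ENNReal.ofReal (b m) ∂μ) ^ p ≤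
      ENNReal.ofReal M ^ p * ∑' m, ENNReal.ofReal (vv β m) * ENNReal.ofReal (b m) ^ p := by
    intro N
    have h := hB (fun m => if m < N then ((b m * poch m α : ℝ) : ℂ) else 0) (by
      refine summable_of_ne_finset_zero (s := Finset.range N) fun m hm => ?_
      rw [Finset.mem_range] at hm
      simp [hm, hp0.ne'])
    simp_rw [w1_eq hp hα hβ (norm_nonneg _), w2_eq hp hβ hβα (norm_nonneg _)] at h
    refine le_trans (le_of_eq ?_) (h.trans ?_)
    · refine tsum_congr fun n => ?_
      congr 2
      have hq := poch_n_pos hβ hβα n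
      have hInt : ∀ m, Integrable (fun t => KK β m n t * b m) (μ.restrict (Ioo 0 1)) := by
        intro m
        have : IntegrableOn (fun t => KK β m n t * b m) (Icc 0 1) μ := by
          refine ContinuousOn.integrableOn_compact isCompact_Icc ?_
          unfold KK
          fun_prop
        exact this.mono_set Ioo_subset_Icc_self
      have hnn : ∀ m, 0 ≤ᵐ[μ.restrict (Ioo 0 1)] fun t => KK β m n t * b m := by
        intro m
        filter_upwards [ae_restrict_mem measurableSet_Ioo] with t ht
        exact mul_nonneg (KK_nonneg hβ m n ht) (hb m)
      have hH : Hab μ α β (fun m => if m < N then ((b m * poch m α : ℝ) : ℂ) else 0) n = 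
          ((poch ((n:ℝ) + β - α) α * 
            ∑ m ∈ Finset.range N, ∫ t in Ioo (0:ℝ) 1, KK β m n t * b m ∂μ : ℝ) : ℂ) := by
        unfold Hab
        rw [tsum_eq_sum (s := Finset.range N)]
        · rw [Finset.mul_sum, Complex.ofReal_sum]
          refine Finset.sum_congr rfl fun m hm => ?_
          rw [Finset.mem_range] at hm
          simp only [hm, if_true]
          rw [← integral_const_mul, ← integral_complex_ofReal]
          congr 1
          ext t
          rw [kker_eq hα hβ hβα, Complex.real_smul, ← Complex.ofReal_mul]
          congr 1
          have hq' := poch_m_pos hα m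
          field_simp
        · intro m hm
          rw [Finset.mem_range] at hm
          simp [hm]
      have hs : 0 ≤ ∑ m ∈ Finset.range N, ∫ t in Ioo (0:ℝ) 1, KK β m n t * b m ∂μ :=
        Finset.sum_nonneg fun m _ => integral_nonneg_of_ae (hnn m)
      rw [hH, Complex.norm_real, Real.norm_of_nonneg (mul_nonneg hq.le hs), 
        mul_div_cancel_left₀ _ hq.ne', ENNReal.ofReal_sum_of_nonneg
          fun m _ => integral_nonneg_of_ae (hnn m)]
      refine Finset.sum_congr rfl fun m _ => ?_
      rw [ofReal_integral_eq_lintegral_ofReal (hInt m) (hnn m)]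
      refine setLIntegral_congr_fun measurableSet_Ioo fun t ht => ?_
      rw [KE, ENNReal.ofReal_mul (KK_nonneg hβ m n ht)]
    · refine mul_le_mul_right (ENNReal.tsum_le_tsum fun m => mul_le_mul_right 
        (ENNReal.rpow_le_rpow (ENNReal.ofReal_le_ofReal ?_) hp0.le) _) _
      have hq' := poch_m_pos hα m
      split_ifs
      · rw [Complex.norm_real, Real.norm_of_nonneg (mul_nonneg (hb m) hq'.le), 
          mul_div_cancel_right₀ _ hq'.ne']
      · simpa using hb m
  rw [ENNReal.tsum_eq_iSup_sum]
  refine iSup_le fun F => ?_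
  have ht : Tendsto (fun N => ∑ n ∈ F, ENNReal.ofReal (vv β n) *
      (∑ m ∈ Finset.range N, ∫⁻ t in Ioo (0:ℝ) 1, KE β m n t * ENNReal.ofReal (b m) ∂μ) ^ p) atTop
      (𝓝 (∑ n ∈ F, ENNReal.ofReal (vv β n) *
      (∑' m, ∫⁻ t in Ioo (0:ℝ) 1, KE β m n t * ENNReal.ofReal (b m) ∂μ) ^ p)) := by
    refine tendsto_finsetSum _ fun n _ => ?_
    refine ENNReal.Tendsto.const_mul ?_ (Or.inr ENNReal.ofReal_ne_top)
    exact (ENNReal.continuous_rpow_const.tendsto _).comp (ENNReal.tendsto_nat_tsum _)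
  exact le_of_tendsto ht (Eventually.of_forall fun N => (ENNReal.sum_le_tsum F).trans (hN N))
lemma gprod (x : ℝ) (hx : 0 < x) (n : ℕ) :
    (∏ j ∈ Finset.range (n + 1), (x + j)) * Real.Gamma x = Real.Gamma (x + n + 1) := by
  induction n with
  | zero => simp [Real.Gamma_add_one hx.ne']
  | succ k ih =>
    rw [Finset.prod_range_succ, mul_right_comm, ih]
    push_cast
    rw [show x + ((k:ℝ) + 1) + 1 = (x + k + 1) + 1 by ring, 
      Real.Gamma_add_one (s := x + k + 1) (by positivity)]
    ring


lemma vv_tendsto {β : ℝ} (hβ : -1 < β) (r : ℝ) :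
    Tendsto (fun n : ℕ => vv β n * ((n:ℝ) + 1) ^ (-r) / (n:ℝ) ^ (β - r)) atTop (𝓝 1) := by
  have hx : 0 < β + 1 := by linarith
  have hG := Real.Gamma_pos_of_pos hx
  have h1 : Tendsto (fun n => Real.Gamma (β + 1) / Real.GammaSeq (β + 1) n) atTop (𝓝 1) := by
    have := (tendsto_const_nhds (x := Real.Gamma (β + 1))).div
      (Real.GammaSeq_tendsto_Gamma (β + 1)) hG.ne'
    rwa [div_self hG.ne'] at this
  have h2 : Tendsto (fun n : ℕ => (n:ℝ) / (n + (β + 1))) atTop (𝓝 1) :=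
    tendsto_natCast_div_add_atTop _
  have h3 : Tendsto (fun n : ℕ => ((n:ℝ) / (n + 1)) ^ r) atTop (𝓝 1) := by
    have := (tendsto_natCast_div_add_atTop (1:ℝ)).rpow_const (p := r) (Or.inl one_ne_zero)
    simpa using this
  have h := (h1.mul h2).mul h3
  simp only [mul_one] at h
  refine h.congr' ?_
  filter_upwards [eventually_gt_atTop 0] with n hn
  have hn' : (0:ℝ) < n := by exact_mod_cast hn
  have hp := gprod (β + 1) hx n
  have hpp : 0 < ∏ j ∈ Finset.range (n + 1), (β + 1 + (j:ℝ)) := 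
    Finset.prod_pos fun j _ => by positivity
  have hg : Real.Gamma (β + 1 + n + 1) = (n + (β + 1)) * Real.Gamma (n + β + 1) := by
    rw [show β + 1 + (n:ℝ) = n + β + 1 by ring, Real.Gamma_add_one (by linarith)]
    ring
  rw [hg] at hp
  have hnb : 0 < (n:ℝ) + (β + 1) := by linarith
  unfold vv Real.GammaSeq
  rw [Real.div_rpow hn'.le (by positivity), Real.rpow_neg (by positivity), 
    Real.rpow_sub hn', Real.rpow_add_one hn'.ne']
  have e : Real.Gamma (n + β + 1) = 
    (∏ j ∈ Finset.range (n + 1), (β + 1 + (j:ℝ))) * Real.Gamma (β + 1) / (n + (β + 1)) := by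
    rw [hp]; field_simp
  rw [e]
  field_simp

lemma vv_summable {β : ℝ} (hβ : -1 < β) (r : ℝ) :
    Summable (fun n : ℕ => vv β n * ((n:ℝ) + 1) ^ (-r)) ↔ β + 1 < r := by
  have h : Asymptotics.IsEquivalent atTop (fun n : ℕ => vv β n * ((n:ℝ) + 1) ^ (-r)) 
      (fun n : ℕ => (n:ℝ) ^ (β - r)) := by
    rw [Asymptotics.isEquivalent_iff_tendsto_one]
    · exact vv_tendsto hβ r
    · filter_upwards [eventually_gt_atTop 0] with n hn
      have hn' : (0:ℝ) < n := by exact_mod_cast hn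
      positivity
  rw [h.summable_iff_nat, Real.summable_nat_rpow]
  constructor <;> intro h <;> linarith

lemma choose_s {β p : ℝ} (hβ : -1 < β) (hp : 1 ≤ p) (j : ℕ) :
    ∃ s : ℝ, (β + 1) / p < s ∧ s < (β + 1) / p + 1 / ((j:ℝ) + 1) ∧
      ∑ n ∈ Finset.range j, vv β n * ((n:ℝ) + 1) ^ (-(s * p)) ≤
        1 / ((j:ℝ) + 1) * ∑' n : ℕ, vv β (n + j) * (((n + j : ℕ):ℝ) + 1) ^ (-(s * p)) := by
  have hp0 : 0 < p := by linarith
  have hx : 0 < β + 1 := by linarith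
  set s0 := (β + 1) / p with hs0
  have hs0p : s0 * p = β + 1 := by rw [hs0]; field_simp
  have hs0pos : 0 < s0 := by positivity
  have hns : ¬ Summable (fun n : ℕ => vv β (n + j) * (((n + j : ℕ):ℝ) + 1) ^ (-(s0 * p))) := by
    rw [summable_nat_add_iff (f := fun n : ℕ => vv β n * ((n:ℝ) + 1) ^ (-(s0 * p))) j,
      vv_summable hβ, hs0p]
    simp
  have hnn : ∀ s (n : ℕ), 0 ≤ vv β n * ((n:ℝ) + 1) ^ (-(s * p)) := fun s n => 
    mul_nonneg (vv_pos hβ n).le (by positivity)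
  rw [not_summable_iff_tendsto_nat_atTop_of_nonneg (fun n => hnn s0 (n + j))] at hns
  obtain ⟨L, hL⟩ := (hns.eventually_gt_atTop (((j:ℝ) + 1) * ∑ n ∈ Finset.range j, vv β n)).exists
  have hcont : ContinuousAt (fun s : ℝ => ∑ i ∈ Finset.range L, 
      vv β (i + j) * (((i + j : ℕ):ℝ) + 1) ^ (-(s * p))) s0 := by
    refine tendsto_finsetSum _ fun i _ => ?_
    refine Tendsto.const_mul _ ?_
    have : Continuous fun s : ℝ => (((i + j : ℕ):ℝ) + 1) ^ (-(s * p)) :=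
      Continuous.rpow continuous_const (by fun_prop) fun _ => Or.inl (by positivity)
    exact this.continuousAt
  have h1 := (hcont.eventually (lt_mem_nhds hL)).filter_mono (nhdsWithin_le_nhds (s := Ioi s0))
  have h2 : ∀ᶠ s in 𝓝[>] s0, s < s0 + 1 / ((j:ℝ) + 1) := 
    (gt_mem_nhds (by
      have : (0:ℝ) < 1 / ((j:ℝ) + 1) := by positivity
      linarith)).filter_mono nhdsWithin_le_nhds
  have h3 : ∀ᶠ s in 𝓝[>] s0, s0 < s := eventually_mem_nhdsWithin
  obtain ⟨s, hs1, hs2, hs3⟩ := (h1.and (h2.and h3)).exists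
  refine ⟨s, hs3, hs2, ?_⟩
  have hsum : Summable (fun n : ℕ => vv β (n + j) * (((n + j : ℕ):ℝ) + 1) ^ (-(s * p))) := by
    rw [summable_nat_add_iff (f := fun n : ℕ => vv β n * ((n:ℝ) + 1) ^ (-(s * p))) j,
      vv_summable hβ, ← hs0p]
    exact mul_lt_mul_of_pos_right hs3 hp0
  have h4 := hsum.sum_le_tsum (Finset.range L) (fun n _ => hnn s (n + j))
  have h5 : ∑ n ∈ Finset.range j, vv β n * ((n:ℝ) + 1) ^ (-(s * p)) ≤ 
      ∑ n ∈ Finset.range j, vv β n := by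
    refine Finset.sum_le_sum fun n _ => ?_
    refine mul_le_of_le_one_right (vv_pos hβ n).le ?_
    refine Real.rpow_le_one_of_one_le_of_nonpos (by simp) ?_
    have : 0 < s * p := mul_pos (by linarith) hp0
    linarith
  rw [one_div, ← div_eq_inv_mul, le_div_iff₀ (by positivity)]
  have h6 := hs1.le.trans h4
  have : (0:ℝ) ≤ j + 1 := by positivity
  nlinarith

lemma jensen {β s t : ℝ} (hβ : -1 < β) (hs : 0 < s) (n j : ℕ) (hj : j ≤ n)
    (ht : t ∈ Ioo (0:ℝ) 1) :
    ENNReal.ofReal ((1 - t) ^ (s - (β + 1)) * (t + (1 + |β - 1|) / ((j:ℝ) + 1)) ^ (-s)) *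
      ENNReal.ofReal (((n:ℝ) + 1) ^ (-s)) ≤ 
    ∑' m : ℕ, KE β m n t * ENNReal.ofReal (((m:ℝ) + 1) ^ (-s)) := by
  have h1t : 0 < 1 - t := by linarith [ht.2]
  have h0t := ht.1
  have hn : (0:ℝ) ≤ n := n.cast_nonneg
  set ε := (1 + |β - 1|) / ((j:ℝ) + 1) with hε
  have hε0 : 0 < ε := by positivity
  have h := whold (Measure.count : Measure ℕ) (1 + s) (by linarith) (fun m => KE β m n t)
    (fun _ => 1) (fun m => (m:ENNReal) + 1) (measurable_of_countable _) (measurable_of_countable _)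
    (measurable_of_countable _) (fun m => by simp) (fun m => by simp)
  simp only [lintegral_count, mul_one, ENNReal.one_rpow] at h
  rw [KE_sum_m hβ n ht, KE_mean hβ n ht, show 1 + s - 1 = s by ring, 
    show 1 - (1 + s) = -s by ring] at h
  have e : ∀ m : ℕ, ((m:ENNReal) + 1) ^ (-s) = ENNReal.ofReal (((m:ℝ) + 1) ^ (-s)) := by
    intro m
    rw [← ENNReal.ofReal_rpow_of_pos (by positivity), ENNReal.ofReal_add (by positivity) zero_le_one]
    simp
  simp_rw [e] at h
  set A := (1 - t) ^ (-(β + 1)) with hA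
  have hA0 : 0 < A := Real.rpow_pos_of_pos h1t _
  have hy0 : 0 < t * (n + β) + 1 := by nlinarith
  have hyle : t * (n + β) + 1 ≤ (n + 1) * (t + ε) := by
    have a1 : 1 + |β - 1| ≤ (n + 1) * ε := by
      rw [hε, ← mul_div_assoc, le_div_iff₀ (by positivity), mul_comm]
      refine mul_le_mul_of_nonneg_right ?_ (by positivity)
      have : (j:ℝ) ≤ n := by exact_mod_cast hj
      linarith
    have a2 : t * (β - 1) ≤ |β - 1| := by
      have := le_abs_self (β - 1)
      have := abs_nonneg (β - 1)
      nlinarith [ht.2]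
    nlinarith
  set D := A * ((n + 1) * (t + ε) / (1 - t)) with hD
  have hD0 : 0 < D := by positivity
  have h' : ENNReal.ofReal (A ^ (1 + s)) ≤ ENNReal.ofReal (D ^ s) * 
      ∑' m : ℕ, KE β m n t * ENNReal.ofReal (((m:ℝ) + 1) ^ (-s)) := by
    rw [← ENNReal.ofReal_rpow_of_pos hA0, ← ENNReal.ofReal_rpow_of_pos hD0]
    refine h.trans ?_
    gcongr
    rw [hD]
    gcongr
  have h3 := mul_le_mul_right h' (ENNReal.ofReal (D ^ (-s)))
  rw [← mul_assoc, ← ENNReal.ofReal_mul (by positivity), ← ENNReal.ofReal_mul (by positivity),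
    ← Real.rpow_add hD0, neg_add_cancel, Real.rpow_zero, ENNReal.ofReal_one, one_mul] at h3
  refine le_trans (le_of_eq ?_) h3
  rw [← ENNReal.ofReal_mul (by positivity)]
  congr 1
  rw [hD, Real.mul_rpow hA0.le (by positivity), Real.div_rpow (by positivity) h1t.le,
    Real.mul_rpow (by positivity) (by positivity), Real.rpow_add hA0, Real.rpow_one,
    Real.rpow_neg hA0.le, Real.rpow_neg h1t.le, sub_eq_add_neg s, Real.rpow_add h1t, ← hA]
  have := Real.rpow_pos_of_pos hA0 s
  field_simp

lemma Jbound (μ : Measure ℝ) [IsFiniteMeasure μ] {p α β M s : ℝ} {j : ℕ}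
    (hp : 1 ≤ p) (hα : -1 < α) (hβ : -1 < β) (hβα : -1 < β - α) (hB : Bd μ p α β M)
    (hs : (β + 1) / p < s)
    (hsj : ∑ n ∈ Finset.range j, vv β n * ((n:ℝ) + 1) ^ (-(s * p)) ≤
        1 / ((j:ℝ) + 1) * ∑' n : ℕ, vv β (n + j) * (((n + j : ℕ):ℝ) + 1) ^ (-(s * p))) :
    ∫⁻ t in Ioo (0:ℝ) 1, ENNReal.ofReal ((1 - t) ^ (s - (β + 1)) * 
      (t + (1 + |β - 1|) / ((j:ℝ) + 1)) ^ (-s)) ∂μ ≤ 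
      ENNReal.ofReal M * ENNReal.ofReal (1 + 1 / ((j:ℝ) + 1)) := by
  have hp0 : 0 < p := by linarith
  have hx : 0 < β + 1 := by linarith
  have hs0 : 0 < s := lt_trans (by positivity) hs
  have hr : β + 1 < s * p := by rwa [div_lt_iff₀ hp0] at hs
  set J := ∫⁻ t in Ioo (0:ℝ) 1, ENNReal.ofReal ((1 - t) ^ (s - (β + 1)) * 
      (t + (1 + |β - 1|) / ((j:ℝ) + 1)) ^ (-s)) ∂μ with hJ
  set u : ℕ → ℝ := fun n => vv β n * ((n:ℝ) + 1) ^ (-(s * p)) with hu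
  have hupos : ∀ n, 0 < u n := fun n => mul_pos (vv_pos hβ n) (by positivity)
  have husum : Summable u := (vv_summable hβ _).2 hr
  have husum' : Summable (fun n => u (n + j)) := (summable_nat_add_iff j).2 husum
  set S := ∑' n, u (n + j) with hS
  have hS0 : 0 < S := husum'.tsum_pos (fun n => (hupos _).le) 0 (hupos _)
  have hE : ∀ n, ENNReal.ofReal (vv β n) * ENNReal.ofReal (((n:ℝ) + 1) ^ (-s)) ^ p =
      ENNReal.ofReal (u n) := by
    intro n
    rw [ENNReal.ofReal_rpow_of_pos (by positivity), ← ENNReal.ofReal_mul (vv_pos hβ n).le,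
      ← Real.rpow_mul (by positivity), neg_mul]
  have h := lowerE μ hp hα hβ hβα hB (fun m => ((m:ℝ) + 1) ^ (-s)) (fun m => by positivity)
  simp_rw [hE] at h
  have hT : ∀ n, j ≤ n → J * ENNReal.ofReal (((n:ℝ) + 1) ^ (-s)) ≤ 
      ∑' m : ℕ, ∫⁻ t in Ioo (0:ℝ) 1, KE β m n t * ENNReal.ofReal (((m:ℝ) + 1) ^ (-s)) ∂μ := by
    intro n hn
    have km := KE_meas β
    rw [← lintegral_tsum (fun m => by fun_prop), hJ, ← lintegral_mul_const' _ _ ENNReal.ofReal_ne_top]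
    exact setLIntegral_mono' measurableSet_Ioo fun t ht => jensen hβ hs0 n j hn ht
  have h1 : J ^ p * ENNReal.ofReal S ≤ ENNReal.ofReal M ^ p * 
      (ENNReal.ofReal (1 + 1 / ((j:ℝ) + 1)) * ENNReal.ofReal S) := by
    calc J ^ p * ENNReal.ofReal S = ∑' n, ENNReal.ofReal (vv β (n + j)) * 
          (J * ENNReal.ofReal ((((n + j : ℕ):ℝ) + 1) ^ (-s))) ^ p := by
          rw [hS, ENNReal.ofReal_tsum_of_nonneg (fun n => (hupos _).le) husum', 
            ← ENNReal.tsum_mul_left]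
          refine tsum_congr fun n => ?_
          rw [ENNReal.mul_rpow_of_nonneg _ _ hp0.le, mul_left_comm, hE]
      _ ≤ ∑' n, ENNReal.ofReal (vv β (n + j)) * 
          (∑' m : ℕ, ∫⁻ t in Ioo (0:ℝ) 1, KE β m (n + j) t * 
            ENNReal.ofReal (((m:ℝ) + 1) ^ (-s)) ∂μ) ^ p := 
          ENNReal.tsum_le_tsum fun n => mul_le_mul_right 
            (ENNReal.rpow_le_rpow (hT _ (Nat.le_add_left _ _)) hp0.le) _
      _ ≤ ∑' n, ENNReal.ofReal (vv β n) * 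
          (∑' m : ℕ, ∫⁻ t in Ioo (0:ℝ) 1, KE β m n t * 
            ENNReal.ofReal (((m:ℝ) + 1) ^ (-s)) ∂μ) ^ p :=
          ENNReal.tsum_comp_le_tsum_of_injective (add_left_injective j) 
            (fun n => ENNReal.ofReal (vv β n) * 
          (∑' m : ℕ, ∫⁻ t in Ioo (0:ℝ) 1, KE β m n t * 
            ENNReal.ofReal (((m:ℝ) + 1) ^ (-s)) ∂μ) ^ p)
      _ ≤ _ := h
      _ ≤ _ := by
          refine mul_le_mul_right ?_ _
          rw [← ENNReal.ofReal_tsum_of_nonneg (fun n => (hupos _).le) husum, 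
            ← ENNReal.ofReal_mul (by positivity)]
          refine ENNReal.ofReal_le_ofReal ?_
          rw [← husum.sum_add_tsum_nat_add j, add_mul, one_mul]
          linarith
  rw [← mul_assoc] at h1
  have h2 : J ^ p ≤ ENNReal.ofReal M ^ p * ENNReal.ofReal (1 + 1 / ((j:ℝ) + 1)) :=
    (ENNReal.mul_le_mul_iff_left (by simpa using hS0) ENNReal.ofReal_ne_top).1 h1
  rw [← ENNReal.rpow_le_rpow_iff hp0, ENNReal.mul_rpow_of_nonneg _ _ hp0.le]
  refine h2.trans (mul_le_mul_right ?_ _)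
  conv_lhs => rw [← ENNReal.rpow_one (ENNReal.ofReal (1 + 1 / ((j:ℝ) + 1)))]
  refine ENNReal.rpow_le_rpow_of_exponent_le ?_ hp
  rw [ENNReal.one_le_ofReal]
  have : (0:ℝ) < 1 / ((j:ℝ) + 1) := by positivity
  linarith

lemma lower (μ : Measure ℝ) [IsFiniteMeasure μ] {p α β M : ℝ}
    (hp : 1 ≤ p) (hα : -1 < α) (hβ : -1 < β) (hβα : -1 < β - α) (hB : Bd μ p α β M) :
    ∫⁻ t in Ioo (0:ℝ) 1, cc p β t ∂μ ≤ ENNReal.ofReal M := by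
  have hp0 : 0 < p := by linarith
  choose s hs1 hs2 hs3 using choose_s hβ hp
  have hinv : Tendsto (fun j : ℕ => 1 / ((j:ℝ) + 1)) atTop (𝓝 0) := 
    tendsto_one_div_add_atTop_nhds_zero_nat
  have hs : Tendsto s atTop (𝓝 ((β + 1) / p)) := by
    refine tendsto_of_tendsto_of_tendsto_of_le_of_le tendsto_const_nhds ?_ 
      (fun j => (hs1 j).le) (fun j => (hs2 j).le)
    simpa using hinv.const_add ((β + 1) / p)
  set f : ℕ → ℝ → ENNReal := fun j t => ENNReal.ofReal ((1 - t) ^ (s j - (β + 1)) * 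
      (t + (1 + |β - 1|) / ((j:ℝ) + 1)) ^ (-(s j))) with hf
  have hlim : ∀ t ∈ Ioo (0:ℝ) 1, Tendsto (fun j => f j t) atTop (𝓝 (cc p β t)) := by
    intro t ht
    have h1t : 0 < 1 - t := by linarith [ht.2]
    refine (ENNReal.continuous_ofReal.tendsto _).comp ?_
    refine Tendsto.mul ?_ ?_
    · have : Tendsto (fun j => s j - (β + 1)) atTop (𝓝 (-(1 - 1 / p) * (β + 1))) := by
        have := hs.sub_const (β + 1)
        convert this using 2
        field_simp
        ring
      exact tendsto_const_nhds.rpow this (Or.inl h1t.ne')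
    · have : Tendsto (fun j : ℕ => t + (1 + |β - 1|) / ((j:ℝ) + 1)) atTop (𝓝 t) := by
        have := (hinv.const_mul (1 + |β - 1|)).const_add t
        simpa [div_eq_mul_inv] using this
      exact this.rpow hs.neg (Or.inl ht.1.ne')
  calc _ = ∫⁻ t in Ioo (0:ℝ) 1, liminf (fun j => f j t) atTop ∂μ :=
        setLIntegral_congr_fun measurableSet_Ioo fun t ht => (hlim t ht).liminf_eq.symm
    _ ≤ liminf (fun j => ∫⁻ t in Ioo (0:ℝ) 1, f j t ∂μ) atTop := 
        lintegral_liminf_le fun j => by simp only [hf]; fun_prop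
    _ ≤ liminf (fun j : ℕ => ENNReal.ofReal M * ENNReal.ofReal (1 + 1 / ((j:ℝ) + 1))) atTop :=
        liminf_le_liminf (Eventually.of_forall fun j => 
          Jbound μ hp hα hβ hβα hB (hs1 j) (hs3 j))
    _ = ENNReal.ofReal M := by
        refine Tendsto.liminf_eq ?_
        have h := (ENNReal.continuous_ofReal.tendsto _).comp (hinv.const_add 1)
        have h2 := ENNReal.Tendsto.const_mul h 
          (Or.inr (ENNReal.ofReal_ne_top (r := M)))
        simpa using h2

/-- For `1 ≤ p < ∞`, `H_μ^{α,β}` is bounded from `ℓ^p_{w₁}` into `ℓ^p_{w₂}` iff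
`C_μ(β,p) = ∫_{(0,1)} (1-t)^{-(1-1/p)(β+1)} t^{-(β+1)/p} dμ(t) < ∞`, and in that case
the operator norm (the least bound `M`) equals `C_μ(β,p)`. -/
theorem Hab_bounded_lp_iff (μ : Measure ℝ) [IsFiniteMeasure μ] (p α β : ℝ)
    (hp : 1 ≤ p) (hα : -1 < α) (hβ : -1 < β) (hβα : -1 < β - α) :
    ((∃ M : ℝ, 0 ≤ M ∧ ∀ a : ℕ → ℂ, Summable (fun m : ℕ => w1 α β p m * ‖a m‖ ^ p) →
        ∑' n : ℕ, ENNReal.ofReal (w2 α β p n * ‖Hab μ α β a n‖ ^ p) ≤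
          ENNReal.ofReal M ^ p *
            ∑' m : ℕ, ENNReal.ofReal (w1 α β p m * ‖a m‖ ^ p)) ↔
      (∫⁻ t in Ioo (0 : ℝ) 1,
        ENNReal.ofReal ((1 - t) ^ (-(1 - 1 / p) * (β + 1)) * t ^ (-((β + 1) / p))) ∂μ) ≠ ⊤) ∧
    ((∃ M : ℝ, 0 ≤ M ∧ ∀ a : ℕ → ℂ, Summable (fun m : ℕ => w1 α β p m * ‖a m‖ ^ p) →
        ∑' n : ℕ, ENNReal.ofReal (w2 α β p n * ‖Hab μ α β a n‖ ^ p) ≤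
          ENNReal.ofReal M ^ p *
            ∑' m : ℕ, ENNReal.ofReal (w1 α β p m * ‖a m‖ ^ p)) →
      IsLeast {M : ℝ | 0 ≤ M ∧ ∀ a : ℕ → ℂ,
          Summable (fun m : ℕ => w1 α β p m * ‖a m‖ ^ p) →
          ∑' n : ℕ, ENNReal.ofReal (w2 α β p n * ‖Hab μ α β a n‖ ^ p) ≤
            ENNReal.ofReal M ^ p *
              ∑' m : ℕ, ENNReal.ofReal (w1 α β p m * ‖a m‖ ^ p)}
        (∫⁻ t in Ioo (0 : ℝ) 1,
          ENNReal.ofReal ((1 - t) ^ (-(1 - 1 / p) * (β + 1)) *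
            t ^ (-((β + 1) / p))) ∂μ).toReal) := by

  refine ⟨⟨?_, ?_⟩, ?_⟩
  · rintro ⟨M, _, hB⟩
    exact ne_top_of_le_ne_top ENNReal.ofReal_ne_top (lower μ hp hα hβ hβα hB)
  · intro hC
    exact ⟨_, ENNReal.toReal_nonneg, upper μ hp hα hβ hβα hC⟩
  · rintro ⟨M, _, hB⟩
    have hC := ne_top_of_le_ne_top ENNReal.ofReal_ne_top (lower μ hp hα hβ hβα hB)
    refine ⟨⟨ENNReal.toReal_nonneg, upper μ hp hα hβ hβα hC⟩, ?_⟩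
    rintro M' ⟨hM', hB'⟩
    exact ENNReal.toReal_le_of_le_ofReal hM' (lower μ hp hα hβ hβα hB')
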